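/- (Proposition 3.7 i.) Assume the form polynomial t is strongly damped, D contains a nonzero vector, and ν_− < ν_+. Then for every λ ∈ (ν_−, ν_+) the form t(λ) is uniformly positive: t(λ)[x] ≥ (λ − ν_−)(ν_+ − λ)‖x‖² for all x ∈ D, with (λ − ν_−)(ν_+ − λ) > 0; moreover t(ν_−)[x] ≥ 0 and t(ν_+)[x] ≥ 0 for all x ∈ D. -/

import Mathlib

/-- The abstract Klein–Gordon quadratic form `t(λ)[x] = ‖G x‖² − ‖V x − λ x‖²`. -/
noncomputable def kgForm {H : Type*} [NormedAddCommGroup H] [InnerProductSpace ℂ H]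
    {D : Submodule ℂ H} (G V : D →ₗ[ℂ] H) (μ : ℝ) (x : D) : ℝ :=
  ‖G x‖ ^ 2 - ‖V x - (μ : ℂ) • (x : H)‖ ^ 2

/-- Half the derivative of `μ ↦ kgForm G V μ x`. -/
noncomputable def kgSlope {H : Type*} [NormedAddCommGroup H] [InnerProductSpace ℂ H]
    {D : Submodule ℂ H} (V : D →ₗ[ℂ] H) (μ : ℝ) (x : D) : ℝ :=
  (inner ℂ (V x - (μ : ℂ) • (x : H)) (x : H)).re

section KleinGordon

variable {H : Type*} [NormedAddCommGroup H] [InnerProductSpace ℂ H]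
  {D : Submodule ℂ H} (G V : D →ₗ[ℂ] H)

theorem kgForm_add (μ h : ℝ) (x : D) :
    kgForm G V (μ + h) x = kgForm G V μ x + 2 * h * kgSlope V μ x - h ^ 2 * ‖(x : H)‖ ^ 2 := by
  have key : V x - ((μ + h : ℝ) : ℂ) • (x : H) =
      (V x - (μ : ℂ) • (x : H)) - (h : ℂ) • (x : H) := by
    push_cast
    module
  simp only [kgForm, kgSlope]
  rw [key, norm_sub_sq (𝕜 := ℂ) (V x - (μ : ℂ) • (x : H)), inner_smul_right, norm_smul, mul_pow,
    Complex.norm_real, Real.norm_eq_abs, sq_abs, RCLike.re_to_complex, Complex.re_ofReal_mul]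
  ring

theorem norm_add_real_smul_sq (u w : H) (s : ℝ) :
    ‖u + (s : ℂ) • w‖ ^ 2 = ‖u‖ ^ 2 + 2 * s * (inner ℂ u w).re + s ^ 2 * ‖w‖ ^ 2 := by
  rw [norm_add_sq (𝕜 := ℂ), inner_smul_right, norm_smul, mul_pow,
    Complex.norm_real, Real.norm_eq_abs, sq_abs, RCLike.re_to_complex, Complex.re_ofReal_mul]
  ring

theorem map_sub_smul_add_smul (μ s : ℝ) (x y : D) :
    V (x + (s : ℂ) • y) - (μ : ℂ) • ((x + (s : ℂ) • y : D) : H) =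
      (V x - (μ : ℂ) • (x : H)) + (s : ℂ) • (V y - (μ : ℂ) • (y : H)) := by
  simp only [map_add, map_smul, Submodule.coe_add, Submodule.coe_smul]
  module

theorem exists_kgForm_add_smul (μ : ℝ) (x y : D) :
    ∃ c : ℝ, ∀ s : ℝ, kgForm G V μ (x + (s : ℂ) • y) =
      kgForm G V μ x + s * c + s ^ 2 * kgForm G V μ y := by
  refine ⟨2 * (inner ℂ (G x) (G y)).re -
    2 * (inner ℂ (V x - (μ : ℂ) • (x : H)) (V y - (μ : ℂ) • (y : H))).re, fun s => ?_⟩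
  simp only [kgForm]
  rw [map_sub_smul_add_smul, map_add, map_smul, norm_add_real_smul_sq, norm_add_real_smul_sq]
  ring

theorem exists_kgSlope_add_smul (μ : ℝ) (x y : D) :
    ∃ c : ℝ, ∀ s : ℝ, kgSlope V μ (x + (s : ℂ) • y) =
      kgSlope V μ x + s * c + s ^ 2 * kgSlope V μ y := by
  refine ⟨(inner ℂ (V x - (μ : ℂ) • (x : H)) (y : H)).re +
    (inner ℂ (V y - (μ : ℂ) • (y : H)) (x : H)).re, fun s => ?_⟩
  simp only [kgSlope]
  rw [map_sub_smul_add_smul, Submodule.coe_add, Submodule.coe_smul]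
  simp only [inner_add_left, inner_add_right, inner_smul_left, inner_smul_right,
    Complex.conj_ofReal, Complex.add_re, Complex.re_ofReal_mul]
  ring

variable {G V}

theorem kgForm_eq_of_zeros {x : D} {p q : ℝ} (hpq : p < q)
    (hp : kgForm G V p x = 0) (hq : kgForm G V q x = 0) (μ : ℝ) :
    kgForm G V μ x = (μ - p) * (q - μ) * ‖(x : H)‖ ^ 2 ∧
      2 * kgSlope V μ x = (p + q - 2 * μ) * ‖(x : H)‖ ^ 2 := by
  have h1 := kgForm_add G V μ (p - μ) x
  have h2 := kgForm_add G V μ (q - μ) x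
  rw [add_sub_cancel, hp] at h1
  rw [add_sub_cancel, hq] at h2
  have hslope : 2 * kgSlope V μ x = (p + q - 2 * μ) * ‖(x : H)‖ ^ 2 := by
    apply mul_left_cancel₀ (sub_ne_zero.2 hpq.ne')
    linear_combination h1 - h2
  refine ⟨?_, hslope⟩
  linear_combination -h1 - (p - μ) * hslope

/-- A real quadratic whose constant and leading coefficients have opposite signs has roots of both
signs; in particular one whose product with a given `c` is nonpositive. -/
theorem exists_root_mul_nonpos {a b : ℝ} (ha : 0 < a) (hb : b < 0) (m c : ℝ) :
    ∃ s : ℝ, a + s * m + s ^ 2 * b = 0 ∧ s * c ≤ 0 := by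
  have hb0 : b ≠ 0 := hb.ne
  have hd : 0 ≤ m ^ 2 - 4 * a * b := by nlinarith [sq_nonneg m, mul_pos ha (neg_pos.2 hb)]
  have hr := Real.sq_sqrt hd
  have habs : |m| ≤ √(m ^ 2 - 4 * a * b) :=
    Real.abs_le_sqrt (by nlinarith [mul_pos ha (neg_pos.2 hb)])
  set r := √(m ^ 2 - 4 * a * b)
  obtain ⟨hl, hu⟩ := abs_le.1 habs
  rcases le_total c 0 with hc | hc
  · refine ⟨(-m - r) / (2 * b), ?_, ?_⟩
    · field_simp
      linear_combination hr
    · exact mul_nonpos_of_nonneg_of_nonpos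
        (div_nonneg_of_nonpos (by linarith) (by linarith)) hc
  · refine ⟨(-m + r) / (2 * b), ?_, ?_⟩
    · field_simp
      linear_combination hr
    · exact mul_nonpos_of_nonpos_of_nonneg
        (div_nonpos_of_nonneg_of_nonpos (by linarith) (by linarith)) hc

/-- For a strongly damped form polynomial the two root zones do not overlap. -/
theorem lower_zero_le_upper_zero {pm pp : D → ℝ}
    (hsd : ∀ x : D, x ≠ 0 → pm x < pp x ∧ kgForm G V (pm x) x = 0 ∧ kgForm G V (pp x) x = 0)
    {x y : D} (hx : x ≠ 0) (hy : y ≠ 0) : pm x ≤ pp y := by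
  by_contra! hlt
  obtain ⟨μ, hyμ, hμx⟩ := exists_between hlt
  obtain ⟨hx0, hx1, hx2⟩ := hsd x hx
  obtain ⟨hy0, hy1, hy2⟩ := hsd y hy
  obtain ⟨hQx, hBx⟩ := kgForm_eq_of_zeros hx0 hx1 hx2 μ
  obtain ⟨hQy, hBy⟩ := kgForm_eq_of_zeros hy0 hy1 hy2 μ
  have hnx : 0 < ‖(x : H)‖ ^ 2 := by
    have : (x : H) ≠ 0 := by simpa using hx
    positivity
  have hny : 0 < ‖(y : H)‖ ^ 2 := by
    have : (y : H) ≠ 0 := by simpa using hy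
    positivity
  have hBx' : 0 < kgSlope V μ x := by
    have := mul_pos (show 0 < pm x + pp x - 2 * μ by linarith) hnx
    linarith
  have hBy' : kgSlope V μ y < 0 := by
    have := mul_neg_of_neg_of_pos (show pm y + pp y - 2 * μ < 0 by linarith) hny
    linarith
  have hQx' : kgForm G V μ x < 0 := by
    rw [hQx]
    exact mul_neg_of_neg_of_pos
      (mul_neg_of_neg_of_pos (by linarith) (by linarith)) hnx
  have hQy' : kgForm G V μ y < 0 := by
    rw [hQy]
    exact mul_neg_of_neg_of_pos
      (mul_neg_of_pos_of_neg (by linarith) (by linarith)) hny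
  obtain ⟨c, hc⟩ := exists_kgForm_add_smul G V μ x y
  obtain ⟨m, hm⟩ := exists_kgSlope_add_smul V μ x y
  obtain ⟨s, hs, hsc⟩ := exists_root_mul_nonpos hBx' hBy' m c
  have hB := (hm s).trans hs
  have hQ : kgForm G V μ (x + (s : ℂ) • y) < 0 := by
    rw [hc s]
    nlinarith [mul_nonneg (sq_nonneg s) (neg_pos.2 hQy').le]
  have hz : x + (s : ℂ) • y ≠ 0 := by
    intro h
    rw [h] at hQ
    simp [kgForm] at hQ
  have h := (hsd _ hz).2.1
  rw [← add_sub_cancel μ (pm (x + (s : ℂ) • y)), kgForm_add, hB] at h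
  have := mul_nonneg (sq_nonneg (pm (x + (s : ℂ) • y) - μ))
    (sq_nonneg ‖((x + (s : ℂ) • y : D) : H)‖)
  linarith

end KleinGordon

/-- Proposition 3.7 i): if the form polynomial `t` is strongly damped and `ν₋ < ν₊`,
then `t(λ)` is uniformly positive for `λ ∈ (ν₋, ν₊)`, namely
`t(λ)[x] ≥ (λ − ν₋)(ν₊ − λ)‖x‖²` with `(λ − ν₋)(ν₊ − λ) > 0`, and `t(ν_∓) ≥ 0`. -/
theorem form_uniformly_positive_in_gap
    {H : Type*} [NormedAddCommGroup H] [InnerProductSpace ℂ H]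
    (D : Submodule ℂ H) (G V : D →ₗ[ℂ] H)
    (pm pp : D → ℝ)
    (hsd : ∀ x : D, x ≠ 0 → pm x < pp x ∧
      kgForm G V (pm x) x = 0 ∧ kgForm G V (pp x) x = 0 ∧
      ∀ μ : ℝ, kgForm G V μ x = 0 → μ = pm x ∨ μ = pp x)
    (hne : ∃ x : D, x ≠ 0)
    (hgap : sSup {r : ℝ | ∃ x : D, x ≠ 0 ∧ pm x = r} <
      sInf {r : ℝ | ∃ x : D, x ≠ 0 ∧ pp x = r}) :
    (∀ lam : ℝ, sSup {r : ℝ | ∃ x : D, x ≠ 0 ∧ pm x = r} < lam →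
      lam < sInf {r : ℝ | ∃ x : D, x ≠ 0 ∧ pp x = r} →
      0 < (lam - sSup {r : ℝ | ∃ x : D, x ≠ 0 ∧ pm x = r}) *
          (sInf {r : ℝ | ∃ x : D, x ≠ 0 ∧ pp x = r} - lam) ∧
      ∀ x : D,
        (lam - sSup {r : ℝ | ∃ x : D, x ≠ 0 ∧ pm x = r}) *
            (sInf {r : ℝ | ∃ x : D, x ≠ 0 ∧ pp x = r} - lam) * ‖(x : H)‖ ^ 2 ≤
          kgForm G V lam x) ∧
    (∀ x : D,
      0 ≤ kgForm G V (sSup {r : ℝ | ∃ x : D, x ≠ 0 ∧ pm x = r}) x ∧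
      0 ≤ kgForm G V (sInf {r : ℝ | ∃ x : D, x ≠ 0 ∧ pp x = r}) x) := by
  have hsep {x y : D} (hx : x ≠ 0) (hy : y ≠ 0) : pm x ≤ pp y :=
    lower_zero_le_upper_zero (G := G) (V := V)
      (fun z hz => ⟨(hsd z hz).1, (hsd z hz).2.1, (hsd z hz).2.2.1⟩) hx hy
  obtain ⟨x₀, hx₀⟩ := hne
  have hle (x : D) (hx : x ≠ 0) : pm x ≤ sSup {r : ℝ | ∃ x : D, x ≠ 0 ∧ pm x = r} :=
    le_csSup ⟨pp x₀, by rintro _ ⟨y, hy, rfl⟩; exact hsep hy hx₀⟩ ⟨x, hx, rfl⟩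
  have hge (x : D) (hx : x ≠ 0) : sInf {r : ℝ | ∃ x : D, x ≠ 0 ∧ pp x = r} ≤ pp x :=
    csInf_le ⟨pm x₀, by rintro _ ⟨y, hy, rfl⟩; exact hsep hx₀ hy⟩ ⟨x, hx, rfl⟩
  set a := sSup {r : ℝ | ∃ x : D, x ≠ 0 ∧ pm x = r}
  set b := sInf {r : ℝ | ∃ x : D, x ≠ 0 ∧ pp x = r}
  have hbound (lam : ℝ) (ha : a ≤ lam) (hb : lam ≤ b) (x : D) :
      (lam - a) * (b - lam) * ‖(x : H)‖ ^ 2 ≤ kgForm G V lam x := by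
    rcases eq_or_ne x 0 with rfl | hx
    · simp [kgForm]
    obtain ⟨h0, h1, h2, -⟩ := hsd x hx
    have hm := hle x hx
    have hp := hge x hx
    rw [(kgForm_eq_of_zeros h0 h1 h2 lam).1]
    have : 0 ≤ lam - pm x := by linarith
    have : 0 ≤ b - lam := by linarith
    gcongr
  refine ⟨fun lam ha hb => ⟨mul_pos (sub_pos.2 ha) (sub_pos.2 hb), hbound lam ha.le hb.le⟩,
    fun x => ⟨?_, ?_⟩⟩
  · simpa using hbound a le_rfl hgap.le x
  · simpa using hbound b hgap.le le_rfl x
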